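/- For N = 2M, η_N(x) = π^{−n/2} L_{M−1}^{(n/2)}(|x|²) e^{−|x|²} satisfies ∫_{ℝⁿ} η_N = 1 and ∫_{ℝⁿ} x^α η_N(x) dx = 0 for every multi-index α with 1 ≤ |α| < 2M. -/

import Mathlib

open MeasureTheory

/-- The generalized Laguerre polynomial
`L_k^{(γ)}(x) = ∑_{i=0}^k (-1)^i binom(k+γ, k-i) x^i / i!`. -/
noncomputable def genLaguerre (k : ℕ) (γ : ℂ) (x : ℂ) : ℂ :=
  ∑ i ∈ Finset.range (k + 1),
    ((-1) ^ i / (Nat.factorial i : ℂ)) *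
      ((∏ m ∈ Finset.range (k - i), (γ + i + 1 + m)) / (Nat.factorial (k - i) : ℂ)) * x ^ i

/-- The generating function `η_{2M}(x) = π^{-n/2} L_{M-1}^{(n/2)}(|x|²) e^{-|x|²}`. -/
noncomputable def etaFun (n M : ℕ) (x : EuclideanSpace ℝ (Fin n)) : ℂ :=
  (Real.pi : ℂ) ^ (-(n : ℂ) / 2) * genLaguerre (M - 1) ((n : ℂ) / 2) ((‖x‖ : ℂ) ^ 2) *
    Complex.exp (-(‖x‖ : ℂ) ^ 2)

/-- Falling-factorial binomial coefficient. -/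
noncomputable def fchoose (a : ℂ) (m : ℕ) : ℂ :=
  (∏ j ∈ Finset.range m, (a - j)) / (Nat.factorial m : ℂ)

lemma fchoose_succ (a : ℂ) (m : ℕ) : ((m : ℂ) + 1) * fchoose a (m + 1) = (a - m) * fchoose a m := by
  unfold fchoose
  rw [Finset.prod_range_succ, Nat.factorial_succ]
  have h1 : ((m : ℂ) + 1) ≠ 0 := by exact_mod_cast Nat.succ_ne_zero m
  have h2 : (Nat.factorial m : ℂ) ≠ 0 := by exact_mod_cast Nat.factorial_ne_zero m
  push_cast
  field_simp

lemma fchoose_add (a b : ℂ) (k : ℕ) :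
    ∑ p ∈ Finset.HasAntidiagonal.antidiagonal k, fchoose a p.1 * fchoose b p.2 = fchoose (a + b) k := by
  induction k with
  | zero => simp [fchoose]
  | succ k ih =>
    have h1 : ((k : ℂ) + 1) ≠ 0 := by exact_mod_cast Nat.succ_ne_zero k
    apply mul_left_cancel₀ h1
    rw [fchoose_succ, ← ih]
    have hA : ∑ p ∈ Finset.HasAntidiagonal.antidiagonal (k + 1), (p.1 : ℂ) * (fchoose a p.1 * fchoose b p.2)
        = ∑ p ∈ Finset.HasAntidiagonal.antidiagonal k, (a - p.1) * (fchoose a p.1 * fchoose b p.2) := by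
      rw [Finset.Nat.sum_antidiagonal_succ]
      simp only [Nat.cast_zero, zero_mul, zero_add]
      refine Finset.sum_congr rfl fun p _ => ?_
      push_cast
      rw [← mul_assoc, fchoose_succ]; ring
    have hB : ∑ p ∈ Finset.HasAntidiagonal.antidiagonal (k + 1), (p.2 : ℂ) * (fchoose a p.1 * fchoose b p.2)
        = ∑ p ∈ Finset.HasAntidiagonal.antidiagonal k, (b - p.2) * (fchoose a p.1 * fchoose b p.2) := by
      rw [Finset.Nat.sum_antidiagonal_succ']
      simp only [Nat.cast_zero, zero_mul, zero_add, add_zero]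
      refine Finset.sum_congr rfl fun p _ => ?_
      push_cast
      have := fchoose_succ b p.2
      linear_combination fchoose a p.1 * this
    have hC : ((k : ℂ) + 1) * ∑ p ∈ Finset.HasAntidiagonal.antidiagonal (k + 1), fchoose a p.1 * fchoose b p.2
        = ∑ p ∈ Finset.HasAntidiagonal.antidiagonal (k + 1), (p.1 : ℂ) * (fchoose a p.1 * fchoose b p.2)
        + ∑ p ∈ Finset.HasAntidiagonal.antidiagonal (k + 1), (p.2 : ℂ) * (fchoose a p.1 * fchoose b p.2) := by
      rw [Finset.mul_sum, ← Finset.sum_add_distrib]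
      refine Finset.sum_congr rfl fun p hp => ?_
      have : ((p.1 : ℂ) + p.2) = k + 1 := by
        exact_mod_cast Finset.HasAntidiagonal.mem_antidiagonal.mp hp
      rw [← this]; ring
    rw [hC, hA, hB, ← Finset.sum_add_distrib, Finset.mul_sum]
    refine Finset.sum_congr rfl fun p hp => ?_
    have : ((p.1 : ℂ) + p.2) = k := by
      exact_mod_cast Finset.HasAntidiagonal.mem_antidiagonal.mp hp
    rw [← this]; ring

lemma laguerre_sum (k : ℕ) (γ s : ℂ) :
    ∑ i ∈ Finset.range (k + 1), ((-1) ^ i / (Nat.factorial i : ℂ)) *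
      ((∏ m ∈ Finset.range (k - i), (γ + i + 1 + m)) / (Nat.factorial (k - i) : ℂ)) *
        (∏ m ∈ Finset.range i, (s + m)) = fchoose (γ + k - s) k := by
  have h : γ + k - s = -s + (γ + k) := by ring
  rw [h, ← fchoose_add, Finset.Nat.sum_antidiagonal_eq_sum_range_succ_mk]
  refine Finset.sum_congr rfl fun i hi => ?_
  have hi' : i ≤ k := Nat.lt_succ_iff.mp (Finset.mem_range.mp hi)
  have e1 : fchoose (-s) i = ((-1) ^ i / (Nat.factorial i : ℂ)) * ∏ m ∈ Finset.range i, (s + m) := by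
    unfold fchoose
    have : ∏ j ∈ Finset.range i, (-s - (j : ℂ)) = ∏ j ∈ Finset.range i, ((-1) * (s + j)) :=
      Finset.prod_congr rfl fun j _ => by ring
    rw [this, Finset.prod_mul_distrib, Finset.prod_const, Finset.card_range]
    ring
  have e2 : ∏ m ∈ Finset.range (k - i), (γ + i + 1 + m) =
      ∏ j ∈ Finset.range (k - i), (γ + k - (j : ℂ)) := by
    rw [← Finset.prod_range_reflect]
    refine Finset.prod_congr rfl fun j hj => ?_
    have hj' := Finset.mem_range.mp hj
    have : ((k - i - 1 - j : ℕ) : ℂ) = k - i - 1 - j := by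
      have h3 : (k - i - 1 - j) + (i + 1 + j) = k := by omega
      have h4 : (((k - i - 1 - j : ℕ) : ℂ)) + (i + 1 + j) = k := by exact_mod_cast h3
      linear_combination h4
    rw [this]; ring
  simp only
  rw [e1, e2]
  unfold fchoose
  ring

lemma fchoose_self (k : ℕ) : fchoose (k : ℂ) k = 1 := by
  have h := laguerre_sum k (0 : ℂ) 0
  unfold fchoose
  have h2 : (Nat.factorial k : ℂ) ≠ 0 := by exact_mod_cast Nat.factorial_ne_zero k
  rw [div_eq_one_iff_eq h2, ← Finset.prod_range_reflect, ← Finset.prod_range_add_one_eq_factorial]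
  push_cast
  refine Finset.prod_congr rfl fun j hj => ?_
  have hj' := Finset.mem_range.mp hj
  have h3 : (k - 1 - j) + (1 + j) = k := by omega
  have h4 : (((k - 1 - j : ℕ) : ℂ)) + (1 + j) = k := by exact_mod_cast h3
  linear_combination -h4

lemma fchoose_zero (k m : ℕ) (h1 : 1 ≤ m) (h2 : m ≤ k) : fchoose ((k : ℂ) - m) k = 0 := by
  unfold fchoose
  rw [Finset.prod_eq_zero (i := k - m) (Finset.mem_range.mpr (by omega)), zero_div]
  rw [Nat.cast_sub h2]; ring

/-- One-dimensional Gaussian monomial. -/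
noncomputable def gmono (a : ℕ) (x : ℝ) : ℂ := (x : ℂ) ^ a * Complex.exp (-(x : ℂ) ^ 2)

lemma gmono_integrable (a : ℕ) : Integrable (gmono a) := by
  have h := (integrable_rpow_mul_exp_neg_mul_sq (b := 1) one_pos (s := a)
    (by have : (0 : ℝ) ≤ a := Nat.cast_nonneg a
        linarith)).ofReal (𝕜 := ℂ)
  refine h.congr (Filter.Eventually.of_forall fun x => ?_)
  simp [gmono]

lemma gmono_hasDerivAt (a : ℕ) (x : ℝ) :
    HasDerivAt (gmono (a + 1)) (((a : ℂ) + 1) * gmono a x - 2 * gmono (a + 2) x) x := by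
  have h1 : HasDerivAt (fun z : ℂ => z ^ (a + 1) * Complex.exp (-z ^ 2))
      (((a : ℂ) + 1) * gmono a x - 2 * gmono (a + 2) x) (x : ℂ) := by
    have := (hasDerivAt_pow (a + 1) (x : ℂ)).mul (((hasDerivAt_pow 2 (x : ℂ)).neg).cexp)
    refine this.congr_deriv ?_
    simp [gmono]; ring
  exact h1.comp_ofReal

lemma gmono_rec (a : ℕ) : ∫ x, gmono (a + 2) x = ((a : ℂ) + 1) / 2 * ∫ x, gmono a x := by
  have i1 := (gmono_integrable a).const_mul ((a : ℂ) + 1)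
  have i2 := (gmono_integrable (a + 2)).const_mul 2
  have := integral_eq_zero_of_hasDerivAt_of_integrable (gmono_hasDerivAt a)
    (i1.sub i2) (gmono_integrable (a + 1))
  rw [integral_sub i1 i2, integral_const_mul, integral_const_mul] at this
  linear_combination -this / 2

lemma gmono_one : ∫ x, gmono 1 x = 0 := by
  have h1 : ∀ x : ℝ, HasDerivAt (gmono 0) (-2 * gmono 1 x) x := by
    intro x
    have h1 : HasDerivAt (fun z : ℂ => z ^ 0 * Complex.exp (-z ^ 2)) (-2 * gmono 1 x) (x : ℂ) := by
      have := (((hasDerivAt_pow 2 (x : ℂ)).neg).cexp)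
      simp only [pow_zero, one_mul]
      refine this.congr_deriv ?_
      simp [gmono]; ring
    exact h1.comp_ofReal
  have := integral_eq_zero_of_hasDerivAt_of_integrable h1
    ((gmono_integrable 1).const_mul _) (gmono_integrable 0)
  rw [integral_const_mul] at this
  simpa using this

lemma gmono_odd (a : ℕ) (ha : Odd a) : ∫ x, gmono a x = 0 := by
  obtain ⟨m, rfl⟩ := ha
  induction m with
  | zero => simpa using gmono_one
  | succ m ih =>
    have : 2 * (m + 1) + 1 = (2 * m + 1) + 2 := by ring
    rw [this, gmono_rec, ih, mul_zero]

lemma gmono_zero : ∫ x, gmono 0 x = (Real.pi : ℂ) ^ (1 / 2 : ℂ) := by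
  have := integral_gaussian_complex (b := 1) (by simp)
  simpa [gmono] using this

/-- n-dimensional integrand. -/
noncomputable def gint {n : ℕ} (α : Fin n → ℕ) (j : ℕ) (x : Fin n → ℝ) : ℂ :=
  (∑ i, (x i : ℂ) ^ 2) ^ j * ∏ i, gmono (α i) (x i)

lemma gint_succ {n : ℕ} (α : Fin n → ℕ) (j : ℕ) (x : Fin n → ℝ) :
    gint α (j + 1) x = ∑ i, gint (Function.update α i (α i + 2)) j x := by
  unfold gint
  rw [← Finset.mul_sum, pow_succ, mul_assoc, Finset.sum_mul]
  congr 1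
  refine Finset.sum_congr rfl fun i _ => ?_
  rw [← Finset.mul_prod_erase _ _ (Finset.mem_univ i),
    ← Finset.mul_prod_erase _ (fun l => gmono (Function.update α i (α i + 2) l) (x l))
      (Finset.mem_univ i)]
  have : ∏ l ∈ Finset.univ.erase i, gmono (Function.update α i (α i + 2) l) (x l)
      = ∏ l ∈ Finset.univ.erase i, gmono (α l) (x l) :=
    Finset.prod_congr rfl fun l hl => by
      rw [Function.update_of_ne (Finset.ne_of_mem_erase hl)]
  rw [this, Function.update_self]
  unfold gmono
  ring

lemma gint_integrable {n : ℕ} (j : ℕ) : ∀ α : Fin n → ℕ, Integrable (gint α j) := by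
  induction j with
  | zero =>
    intro α
    have := Integrable.fintype_prod (μ := fun _ : Fin n => (volume : Measure ℝ))
      (f := fun i => gmono (α i)) (fun i => gmono_integrable (α i))
    refine this.congr (Filter.Eventually.of_forall fun x => ?_)
    simp [gint]
  | succ j ih =>
    intro α
    have : gint α (j + 1) = fun x => ∑ i, gint (Function.update α i (α i + 2)) j x :=
      funext (gint_succ α j)
    rw [this]
    exact integrable_finsetSum _ fun i _ => ih _

lemma gint_zero {n : ℕ} (α : Fin n → ℕ) : ∫ x, gint α 0 x = ∏ i, ∫ x, gmono (α i) x := by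
  rw [← integral_fintype_prod_volume_eq_prod]
  simp [gint]

lemma gint_update {n : ℕ} (α : Fin n → ℕ) (i : Fin n) :
    ∫ x, gint (Function.update α i (α i + 2)) 0 x = ((α i : ℂ) + 1) / 2 * ∫ x, gint α 0 x := by
  rw [gint_zero, gint_zero, ← Finset.mul_prod_erase _ _ (Finset.mem_univ i),
    ← Finset.mul_prod_erase _ (fun l => ∫ x, gmono (α l) x) (Finset.mem_univ i)]
  have : ∏ l ∈ Finset.univ.erase i, ∫ x, gmono (Function.update α i (α i + 2) l) x
      = ∏ l ∈ Finset.univ.erase i, ∫ x, gmono (α l) x :=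
    Finset.prod_congr rfl fun l hl => by
      rw [Function.update_of_ne (Finset.ne_of_mem_erase hl)]
  rw [this, Function.update_self, gmono_rec, mul_assoc]

lemma gint_integral {n : ℕ} (j : ℕ) : ∀ α : Fin n → ℕ, ∫ x, gint α j x =
    (∏ m ∈ Finset.range j, (((∑ i, (α i : ℂ)) + n) / 2 + m)) * ∫ x, gint α 0 x := by
  induction j with
  | zero => intro α; simp
  | succ j ih =>
    intro α
    simp_rw [gint_succ α j]
    rw [integral_finsetSum _ fun i _ => gint_integrable j _]
    have hs : ∀ i, ∑ l, ((Function.update α i (α i + 2) l : ℕ) : ℂ) = (∑ l, (α l : ℂ)) + 2 := by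
      intro i
      have : ∑ l, Function.update α i (α i + 2) l = (∑ l, α l) + 2 := by
        rw [Finset.sum_update_of_mem (Finset.mem_univ i),
          ← Finset.add_sum_erase _ α (Finset.mem_univ i), Finset.sdiff_singleton_eq_erase]
        ring
      exact_mod_cast this
    have : ∀ i ∈ Finset.univ, ∫ x, gint (Function.update α i (α i + 2)) j x =
        ((α i : ℂ) + 1) * ((∏ m ∈ Finset.range j, (((∑ l, (α l : ℂ)) + n) / 2 + (m + 1 : ℕ))) *
          (∫ x, gint α 0 x) / 2) := by
      intro i _
      rw [ih, gint_update, hs]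
      have : ∏ m ∈ Finset.range j, (((∑ l, (α l : ℂ)) + 2 + n) / 2 + m) =
          ∏ m ∈ Finset.range j, (((∑ l, (α l : ℂ)) + n) / 2 + (m + 1 : ℕ)) :=
        Finset.prod_congr rfl fun m _ => by push_cast; ring
      rw [this]; ring
    rw [Finset.sum_congr rfl this, ← Finset.sum_mul, Finset.sum_add_distrib,
      Finset.prod_range_succ']
    simp
    ring

lemma main_integral (n M : ℕ) (α : Fin n → ℕ) :
    (∫ x : EuclideanSpace ℝ (Fin n), (∏ i, ((x i : ℝ) : ℂ) ^ α i) * etaFun n M x) =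
      (Real.pi : ℂ) ^ (-(n : ℂ) / 2) *
        (fchoose (((M - 1 : ℕ) : ℂ) - (∑ i, (α i : ℂ)) / 2) (M - 1) * ∏ i, ∫ x, gmono (α i) x) := by
  rw [← (PiLp.volume_preserving_toLp (Fin n)).integral_comp
    (MeasurableEquiv.toLp 2 (Fin n → ℝ)).measurableEmbedding]
  have hpt : ∀ x : Fin n → ℝ, (∏ i, (((WithLp.toLp 2 x : EuclideanSpace ℝ (Fin n)) i : ℝ) : ℂ) ^ α i) *
      etaFun n M (WithLp.toLp 2 x) = (Real.pi : ℂ) ^ (-(n : ℂ) / 2) *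
      ∑ i ∈ Finset.range (M - 1 + 1), ((-1) ^ i / (Nat.factorial i : ℂ)) *
      ((∏ m ∈ Finset.range (M - 1 - i), ((n : ℂ) / 2 + i + 1 + m)) /
        (Nat.factorial (M - 1 - i) : ℂ)) * gint α i x := by
    intro x
    have hn : ((‖(WithLp.toLp 2 x : EuclideanSpace ℝ (Fin n))‖ : ℝ) : ℂ) ^ 2 = ∑ i, (x i : ℂ) ^ 2 := by
      have := EuclideanSpace.real_norm_sq_eq (WithLp.toLp 2 x : EuclideanSpace ℝ (Fin n))
      exact_mod_cast this
    have he : ∏ i, gmono (α i) (x i) =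
        (∏ i, (x i : ℂ) ^ α i) * Complex.exp (-∑ i, (x i : ℂ) ^ 2) := by
      unfold gmono
      rw [Finset.prod_mul_distrib, ← Complex.exp_sum, Finset.sum_neg_distrib]
    unfold etaFun genLaguerre gint
    rw [hn, he]
    simp only [Finset.mul_sum, Finset.sum_mul]
    refine Finset.sum_congr rfl fun i _ => ?_
    ring
  simp_rw [hpt]
  rw [integral_const_mul, integral_finsetSum _ fun i _ => (gint_integrable i α).const_mul _]
  congr 1
  simp_rw [integral_const_mul]
  rw [← gint_zero]
  have h : ((M - 1 : ℕ) : ℂ) - (∑ i, (α i : ℂ)) / 2 =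
      (n : ℂ) / 2 + (M - 1 : ℕ) - ((∑ i, (α i : ℂ)) + n) / 2 := by ring
  rw [h, ← laguerre_sum, Finset.sum_mul]
  refine Finset.sum_congr rfl fun i _ => ?_
  rw [gint_integral i α]
  ring

/-- `η_{2M}` satisfies the moment conditions of order `N = 2M`:
`∫ η_{2M} = 1` and `∫ x^α η_{2M}(x) dx = 0` for all multi-indices `α` with `1 ≤ |α| < 2M`. -/
theorem stmt9 (n M : ℕ) (hM : 1 ≤ M) :
    (∫ x : EuclideanSpace ℝ (Fin n), etaFun n M x) = 1 ∧
      ∀ α : Fin n → ℕ, 1 ≤ ∑ i, α i → ∑ i, α i < 2 * M →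
        (∫ x : EuclideanSpace ℝ (Fin n), (∏ i, ((x i : ℝ) : ℂ) ^ α i) * etaFun n M x) = 0 := by
  constructor
  · have h := main_integral n M (fun _ => 0)
    simp only [pow_zero, Finset.prod_const_one, one_mul, Nat.cast_zero, Finset.sum_const_zero,
      zero_div, sub_zero, fchoose_self, gmono_zero, Finset.prod_const, Finset.card_univ,
      Fintype.card_fin] at h
    rw [h, ← Complex.cpow_nat_mul, ← Complex.cpow_add _ _ (by exact_mod_cast Real.pi_ne_zero)]
    have : -(n : ℂ) / 2 + n * (1 / 2) = 0 := by ring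
    rw [this, Complex.cpow_zero]
  · intro α h1 h2
    rw [main_integral]
    rcases Nat.even_or_odd (∑ i, α i) with he | ho
    · obtain ⟨m, hm⟩ := he
      have hc : (∑ i, (α i : ℂ)) / 2 = m := by
        have : (∑ i, (α i : ℂ)) = m + m := by exact_mod_cast hm
        rw [this]; ring
      rw [hc, fchoose_zero _ m (by omega) (by omega)]
      simp
    · have : ∃ i, Odd (α i) := by
        by_contra hcon
        push Not at hcon
        have : Even (∑ i, α i) :=
          Finset.even_sum _ fun i _ => Nat.not_odd_iff_even.mp (hcon i)
        exact (Nat.not_even_iff_odd.mpr ho) this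
      obtain ⟨i, hi⟩ := this
      rw [Finset.prod_eq_zero (Finset.mem_univ i) (gmono_odd _ hi)]
      simp
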